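/- Let k ≥ 2, let θ ∈ S^{k-1}, and let f : [−1, 1] → [0, ∞) be measurable with 0 < ∫_{S^{k-1}} f(⟨x, θ⟩) dσ_{k-1}(x) < ∞; let P_{θ;f} be the probability measure on S^{k-1} with density x ↦ c_{k,f} f(⟨x, θ⟩) with respect to σ_{k-1}. Then the pushforward of P_{θ;f} under the map x ↦ S_θ(x) (with S_θ(±θ) := 0) is the uniform probability distribution on the subsphere S^{θ⊥} := {v ∈ ℝ^k : ‖v‖ = 1, ⟨v, θ⟩ = 0}, namely the (k−2)-dimensional Hausdorff measure restricted to S^{θ⊥} and normalized to total mass 1. -/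

import Mathlib

open MeasureTheory
open scoped RealInnerProductSpace Classical

/-- Spherical sign of `x` relative to `θ`, set to `0` at `x = ±θ`. -/
noncomputable def sSign {k : ℕ} (θ x : EuclideanSpace ℝ (Fin k)) :
    EuclideanSpace ℝ (Fin k) :=
  if x = θ ∨ x = -θ then 0 else ‖x - ⟪x, θ⟫ • θ‖⁻¹ • (x - ⟪x, θ⟫ • θ)

/-- The surface area measure on the unit sphere `S^{k-1} ⊆ ℝ^k`: the
`(k−1)`-dimensional Hausdorff measure restricted to the sphere. -/
noncomputable def sphereMeasure (k : ℕ) : Measure (EuclideanSpace ℝ (Fin k)) :=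
  (Measure.hausdorffMeasure ((k : ℝ) - 1)).restrict
    (Metric.sphere (0 : EuclideanSpace ℝ (Fin k)) 1)

/-- The uniform probability distribution on the subsphere
`S^{θ⊥} = {v : ‖v‖ = 1, ⟨v,θ⟩ = 0}`: the `(k−2)`-dimensional Hausdorff measure
restricted to `S^{θ⊥}` and normalized to total mass `1`. -/
noncomputable def subsphereUniform {k : ℕ} (θ : EuclideanSpace ℝ (Fin k)) :
    Measure (EuclideanSpace ℝ (Fin k)) :=
  (((Measure.hausdorffMeasure ((k : ℝ) - 2)).restrict
      {v : EuclideanSpace ℝ (Fin k) | ‖v‖ = 1 ∧ ⟪v, θ⟫ = 0}) Set.univ)⁻¹ •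
    ((Measure.hausdorffMeasure ((k : ℝ) - 2)).restrict
      {v : EuclideanSpace ℝ (Fin k) | ‖v‖ = 1 ∧ ⟪v, θ⟫ = 0})

section InvariantMeasure

variable {E : Type*} [NormedAddCommGroup E] [InnerProductSpace ℝ E]

/-- Vectors of equal norm in the orthogonal complement of `θ` are exchanged by an isometry
fixing `θ`. -/
theorem exists_isometry_fixing_map_eq {θ t t' : E} (ht : ⟪t, θ⟫ = 0) (ht' : ⟪t', θ⟫ = 0)
    (h : ‖t‖ = ‖t'‖) : ∃ g : E ≃ₗᵢ[ℝ] E, g θ = θ ∧ g t = t' := by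
  refine ⟨(ℝ ∙ (t - t'))ᗮ.reflection, ?_, Submodule.reflection_sub h⟩
  apply Submodule.reflection_mem_subspace_eq_self
  rw [Submodule.mem_orthogonal_singleton_iff_inner_right, inner_sub_left, ht, ht', sub_zero]

variable [MeasurableSpace E]

theorem charFun_sub_inner_smul {μ : Measure E} {θ : E} (hμ : ∀ᵐ x ∂μ, ⟪x, θ⟫ = 0) (t : E) :
    charFun μ (t - ⟪t, θ⟫ • θ) = charFun μ t := by
  rw [charFun_apply, charFun_apply]
  refine integral_congr_ae ?_
  filter_upwards [hμ] with x hx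
  simp [inner_sub_right, inner_smul_right, hx]

variable [BorelSpace E]

theorem charFun_eq_of_map_eq {μ : Measure E} (g : E ≃ₗᵢ[ℝ] E) (hg : μ.map g = μ) (t : E) :
    charFun μ (g t) = charFun μ t := by
  conv_lhs => rw [← hg]
  have hgm : MeasurableEmbedding g := g.toHomeomorph.measurableEmbedding
  rw [charFun_apply, charFun_apply, hgm.integral_map]
  simp

variable [CompleteSpace E] [SecondCountableTopology E]

/-- A probability measure on the unit sphere of the orthogonal complement of a unit vector `θ`
that is invariant under all linear isometries fixing `θ` is unique. -/
theorem eq_of_invariant_subsphere {θ : E} (hθ : ‖θ‖ = 1) (μ ν : Measure E)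
    [IsProbabilityMeasure μ] [IsProbabilityMeasure ν]
    (hμ : ∀ᵐ x ∂μ, ‖x‖ = 1 ∧ ⟪x, θ⟫ = 0) (hν : ∀ᵐ x ∂ν, ‖x‖ = 1 ∧ ⟪x, θ⟫ = 0)
    (hμi : ∀ g : E ≃ₗᵢ[ℝ] E, g θ = θ → μ.map g = μ)
    (hνi : ∀ g : E ≃ₗᵢ[ℝ] E, g θ = θ → ν.map g = ν) : μ = ν := by
  have average : ∀ (ρ ρ' : Measure E) [IsProbabilityMeasure ρ] [IsProbabilityMeasure ρ'],
      (∀ᵐ x ∂ρ', ‖x‖ = 1 ∧ ⟪x, θ⟫ = 0) → (∀ g : E ≃ₗᵢ[ℝ] E, g θ = θ → ρ.map g = ρ) →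
      ∀ t : E, ⟪t, θ⟫ = 0 →
        ∫ y, ∫ x, Complex.exp (((‖t‖ * ⟪x, y⟫ : ℝ) : ℂ) * Complex.I) ∂ρ ∂ρ' = charFun ρ t := by
    intro ρ ρ' _ _ hρ' hρ t ht
    have : ∀ᵐ y ∂ρ', ∫ x, Complex.exp (((‖t‖ * ⟪x, y⟫ : ℝ) : ℂ) * Complex.I) ∂ρ
        = charFun ρ t := by
      filter_upwards [hρ'] with y hy
      obtain ⟨g, hgθ, hg⟩ := exists_isometry_fixing_map_eq (θ := θ) (t := t) (t' := ‖t‖ • y) ht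
        (by simp [inner_smul_left, hy.2]) (by simp [norm_smul, hy.1])
      rw [← charFun_eq_of_map_eq g (hρ g hgθ) t, hg, charFun_apply]
      simp [inner_smul_right]
    rw [integral_congr_ae this]
    simp
  refine Measure.ext_of_charFun (funext fun t => ?_)
  rw [← charFun_sub_inner_smul (hμ.mono fun _ h => h.2),
    ← charFun_sub_inner_smul (hν.mono fun _ h => h.2)]
  have ht : ⟪t - ⟪t, θ⟫ • θ, θ⟫ = 0 := by
    simp [inner_sub_left, inner_smul_left, hθ]
  rw [← average μ ν hν hμi _ ht, ← average ν μ hμ hνi _ ht, integral_integral_swap]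
  · simp_rw [real_inner_comm]
  · refine Integrable.of_bound (C := 1) (Continuous.aestronglyMeasurable ?_) ?_
    · unfold Function.uncurry
      fun_prop
    · refine Filter.Eventually.of_forall fun p => ?_
      simp only [Function.uncurry]
      rw [Complex.norm_exp_ofReal_mul_I]

end InvariantMeasure

section HausdorffSphere

variable {F : Type*} [NormedAddCommGroup F] [InnerProductSpace ℝ F]

/-- The closed hemisphere opposite to `v` lies in the image of a ball under the inverse
stereographic projection from `v`. -/
theorem exists_stereoInvFunAux_eq {v x : F} (hv : ‖v‖ = 1) (hx : ‖x‖ = 1) (h : ⟪x, v⟫ ≤ 0) :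
    ∃ w ∈ (ℝ ∙ v)ᗮ, ‖w‖ ≤ 2 ∧ stereoInvFunAux v w = x := by
  set s := ⟪x, v⟫ with hs
  have h1 : (1 - s) ≠ 0 := by linarith
  have hs1 : -1 ≤ s := by
    have := abs_real_inner_le_norm x v
    rw [hv, hx] at this
    linarith [neg_abs_le s, this]
  have hn : ‖x - s • v‖ ^ 2 = 1 - s ^ 2 := by
    rw [norm_sub_sq_real, inner_smul_right, norm_smul, hv, hx, ← hs, mul_one,
      Real.norm_eq_abs, sq_abs]
    ring
  have hw : ‖(2 / (1 - s)) • (x - s • v)‖ ^ 2 = 4 * (1 + s) / (1 - s) := by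
    rw [norm_smul, mul_pow, hn, Real.norm_eq_abs, sq_abs]
    field_simp
    ring
  refine ⟨(2 / (1 - s)) • (x - s • v), ?_, ?_, ?_⟩
  · rw [Submodule.mem_orthogonal_singleton_iff_inner_left]
    simp [inner_smul_left, inner_sub_left, hv, ← hs]
  · refine (sq_le_sq₀ (norm_nonneg _) zero_le_two).1 ?_
    rw [hw, div_le_iff₀ (by linarith)]
    linarith
  · have h8 : 4 * (1 + s) / (1 - s) + 4 = 8 / (1 - s) := by field_simp; ring
    rw [stereoInvFunAux_apply, hw, h8]
    match_scalars <;> field_simp <;> ring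

variable [FiniteDimensional ℝ F] [MeasurableSpace F] [BorelSpace F]

theorem hausdorffMeasure_hemisphere_lt_top {m : ℕ} [Fact (Module.finrank ℝ F = m + 1)]
    {v : F} (hv : ‖v‖ = 1) :
    Measure.hausdorffMeasure (m : ℝ) {x : F | ‖x‖ = 1 ∧ ⟪x, v⟫ ≤ 0} < ⊤ := by
  have hv0 : v ≠ 0 := by rintro rfl; simp at hv
  have hW : Module.finrank ℝ (ℝ ∙ v)ᗮ = m := Submodule.finrank_orthogonal_span_singleton hv0
  have hcd : ContDiff ℝ 1 fun w : (ℝ ∙ v)ᗮ => stereoInvFunAux v (w : F) :=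
    contDiff_stereoInvFunAux.comp (ℝ ∙ v)ᗮ.subtypeL.contDiff
  obtain ⟨K, hK⟩ := hcd.locallyLipschitz.locallyLipschitzOn.exists_lipschitzOnWith_of_compact
    (isCompact_closedBall (0 : (ℝ ∙ v)ᗮ) 2)
  have hfin : Measure.hausdorffMeasure (m : ℝ) (Metric.closedBall (0 : (ℝ ∙ v)ᗮ) 2) < ⊤ := by
    rw [← hW]
    exact (isCompact_closedBall _ _).measure_lt_top
  refine lt_of_le_of_lt (measure_mono ?_)
    ((hK.hausdorffMeasure_image_le (Nat.cast_nonneg m)).trans_lt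
      (ENNReal.mul_lt_top (ENNReal.rpow_lt_top_of_nonneg (Nat.cast_nonneg m)
        ENNReal.coe_ne_top) hfin))
  rintro x ⟨hx, hxv⟩
  obtain ⟨w, hwW, hw2, hwx⟩ := exists_stereoInvFunAux_eq hv hx hxv
  exact ⟨⟨w, hwW⟩, by simpa using hw2, hwx⟩

theorem hausdorffMeasure_sphere_lt_top {m : ℕ} [Fact (Module.finrank ℝ F = m + 1)] :
    Measure.hausdorffMeasure (m : ℝ) (Metric.sphere (0 : F) 1) < ⊤ := by
  have : Nontrivial F := Module.nontrivial_of_finrank_eq_succ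
    (Fact.out (p := Module.finrank ℝ F = m + 1))
  obtain ⟨v, hv⟩ := exists_norm_eq F zero_le_one
  refine (measure_mono (fun x hx => ?_)).trans_lt (measure_union_lt_top
    (hausdorffMeasure_hemisphere_lt_top (m := m) hv)
    (hausdorffMeasure_hemisphere_lt_top (m := m) (v := -v) (by simpa using hv)))
  rw [mem_sphere_zero_iff_norm] at hx
  rcases le_total ⟪x, v⟫ 0 with h | h
  · exact Or.inl ⟨hx, h⟩
  · exact Or.inr ⟨hx, by simpa using h⟩

theorem hausdorffMeasure_sphere_pos {m : ℕ} [Fact (Module.finrank ℝ F = m + 1)] :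
    0 < Measure.hausdorffMeasure (m : ℝ) (Metric.sphere (0 : F) 1) := by
  have : Nontrivial F := Module.nontrivial_of_finrank_eq_succ
    (Fact.out (p := Module.finrank ℝ F = m + 1))
  obtain ⟨v, hv⟩ := exists_norm_eq F zero_le_one
  have hv0 : v ≠ 0 := by rintro rfl; simp at hv
  have hW : Module.finrank ℝ (ℝ ∙ v)ᗮ = m := Submodule.finrank_orthogonal_span_singleton hv0
  have hball : 0 < Measure.hausdorffMeasure (m : ℝ) (Metric.ball (0 : (ℝ ∙ v)ᗮ) 1) := by
    rw [← hW]
    exact Metric.measure_ball_pos _ _ one_pos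
  refine hball.trans_le ((measure_mono ?_).trans
    (hausdorffMeasure_orthogonalProjectionOnto_le (ℝ ∙ v)ᗮ m _ (Nat.cast_nonneg m)))
  intro w hw
  have hw1 : ‖(w : F)‖ < 1 := by simpa using hw
  have hwv : ⟪(w : F), v⟫ = 0 := Submodule.mem_orthogonal_singleton_iff_inner_left.1 w.2
  refine ⟨w + √(1 - ‖(w : F)‖ ^ 2) • v, ?_, ?_⟩
  · rw [mem_sphere_zero_iff_norm, ← sq_eq_sq₀ (norm_nonneg _) zero_le_one, norm_add_sq_real,
      inner_smul_right, hwv, norm_smul, hv, mul_one, Real.norm_eq_abs, sq_abs, Real.sq_sqrt]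
    · ring
    · nlinarith [norm_nonneg (w : F)]
  · rw [map_add, map_smul, Submodule.orthogonalProjectionOnto_mem_subspace_eq_self,
      Submodule.orthogonalProjectionOnto_orthogonalComplement_singleton_eq_zero, smul_zero,
      add_zero]

end HausdorffSphere

theorem subsphere_eq_image {k : ℕ} (θ : EuclideanSpace ℝ (Fin k)) :
    {v : EuclideanSpace ℝ (Fin k) | ‖v‖ = 1 ∧ ⟪v, θ⟫ = 0}
      = ((↑) : (ℝ ∙ θ)ᗮ → EuclideanSpace ℝ (Fin k)) '' Metric.sphere 0 1 := by
  ext x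
  constructor
  · rintro ⟨h1, h2⟩
    exact ⟨⟨x, Submodule.mem_orthogonal_singleton_iff_inner_left.2 h2⟩, by simpa using h1, rfl⟩
  · rintro ⟨w, hw, rfl⟩
    exact ⟨by simpa using hw, Submodule.mem_orthogonal_singleton_iff_inner_left.1 w.2⟩

theorem measurableSet_subsphere {k : ℕ} (θ : EuclideanSpace ℝ (Fin k)) :
    MeasurableSet {v : EuclideanSpace ℝ (Fin k) | ‖v‖ = 1 ∧ ⟪v, θ⟫ = 0} := by
  rw [Set.ofPred_and]
  exact (measurableSet_eq_fun (by fun_prop) (by fun_prop)).inter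
    (measurableSet_eq_fun (by fun_prop) (by fun_prop))

theorem hausdorffMeasure_subsphere {k : ℕ} (hk : 2 ≤ k) {θ : EuclideanSpace ℝ (Fin k)}
    (hθ : ‖θ‖ = 1) :
    0 < Measure.hausdorffMeasure ((k : ℝ) - 2)
      {v : EuclideanSpace ℝ (Fin k) | ‖v‖ = 1 ∧ ⟪v, θ⟫ = 0} ∧
    Measure.hausdorffMeasure ((k : ℝ) - 2)
      {v : EuclideanSpace ℝ (Fin k) | ‖v‖ = 1 ∧ ⟪v, θ⟫ = 0} < ⊤ := by
  obtain ⟨m, rfl⟩ := Nat.exists_eq_add_of_le' hk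
  have hd : ((m + 2 : ℕ) : ℝ) - 2 = m := by push_cast; ring
  have hθ0 : θ ≠ 0 := by rintro rfl; simp at hθ
  have : Fact (Module.finrank ℝ (EuclideanSpace ℝ (Fin (m + 2))) = (m + 1) + 1) := ⟨by simp⟩
  have : Fact (Module.finrank ℝ (ℝ ∙ θ)ᗮ = m + 1) :=
    ⟨Submodule.finrank_orthogonal_span_singleton hθ0⟩
  rw [hd, subsphere_eq_image,
    isometry_subtype_coe.hausdorffMeasure_image (Or.inl (Nat.cast_nonneg m))]
  exact ⟨hausdorffMeasure_sphere_pos, hausdorffMeasure_sphere_lt_top⟩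

theorem isProbabilityMeasure_subsphereUniform {k : ℕ} (hk : 2 ≤ k)
    {θ : EuclideanSpace ℝ (Fin k)} (hθ : ‖θ‖ = 1) :
    IsProbabilityMeasure (subsphereUniform θ) := by
  obtain ⟨h0, h1⟩ := hausdorffMeasure_subsphere hk hθ
  refine ⟨?_⟩
  rw [subsphereUniform, Measure.smul_apply, Measure.restrict_apply_univ, smul_eq_mul]
  exact ENNReal.inv_mul_cancel h0.ne' h1.ne

theorem map_restrict_hausdorffMeasure {X : Type*} [EMetricSpace X] [MeasurableSpace X]
    [BorelSpace X] (g : X ≃ᵢ X) (d : ℝ) {s : Set X} (hs : MeasurableSet s) (hgs : g ⁻¹' s = s) :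
    ((Measure.hausdorffMeasure d).restrict s).map g = (Measure.hausdorffMeasure d).restrict s := by
  conv_lhs => rw [← hgs]
  exact ((g.measurePreserving_hausdorffMeasure d).restrict_preimage hs).map_eq

theorem subsphereUniform_map {k : ℕ} {θ : EuclideanSpace ℝ (Fin k)}
    (g : EuclideanSpace ℝ (Fin k) ≃ₗᵢ[ℝ] EuclideanSpace ℝ (Fin k)) (hg : g θ = θ) :
    (subsphereUniform θ).map g = subsphereUniform θ := by
  rw [subsphereUniform, Measure.map_smul]
  congr 1
  refine map_restrict_hausdorffMeasure g.toIsometryEquiv _ (measurableSet_subsphere θ) ?_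
  ext x
  have : ⟪g x, θ⟫ = ⟪x, θ⟫ := by
    conv_lhs => rw [← hg]
    exact g.inner_map_map x θ
  simp [this]

theorem measurable_sSign {k : ℕ} (θ : EuclideanSpace ℝ (Fin k)) :
    Measurable fun x => sSign θ x := by
  unfold sSign
  refine Measurable.ite ?_ measurable_const (by fun_prop)
  exact (measurableSet_singleton θ).union (measurableSet_singleton (-θ))

theorem sSign_map {k : ℕ} {θ : EuclideanSpace ℝ (Fin k)}
    (g : EuclideanSpace ℝ (Fin k) ≃ₗᵢ[ℝ] EuclideanSpace ℝ (Fin k)) (hg : g θ = θ)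
    (x : EuclideanSpace ℝ (Fin k)) : sSign θ (g x) = g (sSign θ x) := by
  have hin : ⟪g x, θ⟫ = ⟪x, θ⟫ := by
    conv_lhs => rw [← hg]
    exact g.inner_map_map x θ
  have hiff : (g x = θ ∨ g x = -θ) ↔ (x = θ ∨ x = -θ) := by
    have h1 : g x = θ ↔ x = θ := by
      conv_lhs => rw [← hg]
      exact g.injective.eq_iff
    have h2 : g x = -θ ↔ x = -θ := by
      conv_lhs => rw [← hg, ← map_neg]
      exact g.injective.eq_iff
    rw [h1, h2]
  have hsub : g x - ⟪x, θ⟫ • θ = g (x - ⟪x, θ⟫ • θ) := by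
    rw [map_sub, map_smul, hg]
  unfold sSign
  by_cases h : x = θ ∨ x = -θ
  · rw [if_pos h, if_pos (hiff.2 h), map_zero]
  · rw [if_neg h, if_neg (fun h' => h (hiff.1 h')), hin, hsub, g.norm_map, map_smul]

theorem sSign_mem_subsphere {k : ℕ} {θ x : EuclideanSpace ℝ (Fin k)} (hθ : ‖θ‖ = 1)
    (hx : ‖x‖ = 1) (hne : ¬(x = θ ∨ x = -θ)) : ‖sSign θ x‖ = 1 ∧ ⟪sSign θ x, θ⟫ = 0 := by
  rw [sSign, if_neg hne]
  constructor
  · refine norm_smul_inv_norm (𝕜 := ℝ) fun h0 => hne ?_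
    have hxθ : x = ⟪x, θ⟫ • θ := sub_eq_zero.1 h0
    have habs : |⟪x, θ⟫| = 1 := by
      have := congrArg norm hxθ
      rwa [norm_smul, hx, hθ, mul_one, Real.norm_eq_abs, eq_comm] at this
    rcases (abs_eq zero_le_one).1 habs with h | h <;> rw [h] at hxθ
    · exact Or.inl (by simpa using hxθ)
    · exact Or.inr (by simpa using hxθ)
  · simp [inner_smul_left, inner_sub_left, hθ]

theorem ae_sphereMeasure_sSign_mem {k : ℕ} (hk : 2 ≤ k) {θ : EuclideanSpace ℝ (Fin k)}
    (hθ : ‖θ‖ = 1) :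
    ∀ᵐ x ∂sphereMeasure k, ‖sSign θ x‖ = 1 ∧ ⟪sSign θ x, θ⟫ = 0 := by
  have hd : (0 : ℝ) < (k : ℝ) - 1 := by
    have : (2 : ℝ) ≤ k := by exact_mod_cast hk
    linarith
  have := Measure.nullSingletonClass_hausdorff (X := EuclideanSpace ℝ (Fin k)) hd
  have hnull : ∀ y : EuclideanSpace ℝ (Fin k), ∀ᵐ x ∂sphereMeasure k, x ≠ y := fun y =>
    ae_restrict_of_ae (measure_eq_zero_iff_ae_notMem.1 (measure_singleton y))
  filter_upwards [hnull θ, hnull (-θ),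
    ae_restrict_mem (μ := Measure.hausdorffMeasure ((k : ℝ) - 1))
      (Metric.isClosed_sphere (x := (0 : EuclideanSpace ℝ (Fin k))) (ε := 1)).measurableSet]
    with x h1 h2 hx
  exact sSign_mem_subsphere hθ (by simpa using hx) (by tauto)

theorem sphereMeasure_map {k : ℕ}
    (g : EuclideanSpace ℝ (Fin k) ≃ₗᵢ[ℝ] EuclideanSpace ℝ (Fin k)) :
    (sphereMeasure k).map g = sphereMeasure k :=
  map_restrict_hausdorffMeasure g.toIsometryEquiv _ Metric.isClosed_sphere.measurableSet
    (by ext x; simp)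

theorem map_withDensity_comp {X : Type*} [MeasurableSpace X] {μ : Measure X} {g : X → X}
    (hg : Measurable g) (hμ : μ.map g = μ) {h : X → ENNReal} (hh : Measurable h)
    (hgh : ∀ x, h (g x) = h x) : (μ.withDensity h).map g = μ.withDensity h := by
  ext s hs
  rw [Measure.map_apply hg hs, withDensity_apply _ (hg hs), withDensity_apply _ hs]
  conv_rhs => rw [← hμ]
  rw [setLIntegral_map hs hh hg]
  simp_rw [hgh]

/-- under the rotationally symmetric distribution `P_{θ;f}`, the spherical
sign `x ↦ S_θ(x)` is uniformly distributed on the subsphere `S^{θ⊥}`. -/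
theorem stmt9 {k : ℕ} (hk : 2 ≤ k) (θ : EuclideanSpace ℝ (Fin k)) (hθ : ‖θ‖ = 1)
    (f : ℝ → ℝ) (hf0 : ∀ t, 0 ≤ f t) (hfm : Measurable f)
    (hint : Integrable (fun x => f ⟪x, θ⟫) (sphereMeasure k))
    (hpos : 0 < ∫ x, f ⟪x, θ⟫ ∂(sphereMeasure k))
    (c : ℝ) (hc : c = (∫ x, f ⟪x, θ⟫ ∂(sphereMeasure k))⁻¹) :
    Measure.map (fun x => sSign θ x)
        ((sphereMeasure k).withDensity fun x => ENNReal.ofReal (c * f ⟪x, θ⟫))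
      = subsphereUniform θ := by
  have hc0 : 0 ≤ c := hc ▸ inv_nonneg.2 hpos.le
  have hdens : Measurable fun x : EuclideanSpace ℝ (Fin k) =>
      ENNReal.ofReal (c * f ⟪x, θ⟫) := by fun_prop
  set P := (sphereMeasure k).withDensity fun x => ENNReal.ofReal (c * f ⟪x, θ⟫) with hP
  have hprob : IsProbabilityMeasure P := by
    refine ⟨?_⟩
    rw [hP, withDensity_apply _ MeasurableSet.univ, Measure.restrict_univ,
      ← ofReal_integral_eq_lintegral_ofReal (hint.const_mul c)
        (Filter.Eventually.of_forall fun x => mul_nonneg hc0 (hf0 _)),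
      integral_const_mul, hc, inv_mul_cancel₀ hpos.ne', ENNReal.ofReal_one]
  have hS := measurable_sSign θ
  have := Measure.isProbabilityMeasure_map (μ := P) hS.aemeasurable
  have := isProbabilityMeasure_subsphereUniform hk hθ
  refine eq_of_invariant_subsphere hθ _ _ ?_ ?_ (fun g hg => ?_)
    (fun g hg => subsphereUniform_map g hg)
  · rw [ae_map_iff hS.aemeasurable (measurableSet_subsphere θ)]
    exact (withDensity_absolutelyContinuous _ _).ae_le (ae_sphereMeasure_sSign_mem hk hθ)
  · exact Measure.ae_smul_measure (ae_restrict_mem (measurableSet_subsphere θ)) _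
  · have hgm : Measurable g := g.continuous.measurable
    have hPg : P.map g = P := by
      refine map_withDensity_comp hgm (sphereMeasure_map g) hdens fun x => ?_
      have : ⟪g x, θ⟫ = ⟪x, θ⟫ := by
        conv_lhs => rw [← hg]
        exact g.inner_map_map x θ
      rw [this]
    conv_rhs => rw [← hPg]
    rw [Measure.map_map hgm hS, Measure.map_map hS hgm]
    congr 1
    ext1 x
    exact (sSign_map g hg x).symm
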